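/- Let p ≥ 2, θ > 1/p, and let f : ℝ → ℝ be smooth, nonnegative, with compactly supported derivative. Then ∫_{{x : f(x) > 0}} (|f'(x)|/f(x)^θ)^p dx ≤ ((p-1)/(θp − 1))^{p/2} ∫_{{x : f(x) > 0}} (√(f(x)|f''(x)|) / f(x)^θ)^p dx. -/

import Mathlib

open MeasureTheory Set Filter Topology

/-- Coefficients of a quadrature rule recovering the quadratic Taylor coefficient. -/
lemma exists_coeff_sum_mul_pow_eq (n : ℕ) (v : Fin (n + 1) → ℝ) (hv : Function.Injective v) :
    ∃ c : Fin (n + 1) → ℝ, ∀ j ∈ Finset.range (n + 1),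
      ∑ i, c i * v i ^ j = if j = 2 then 1 else 0 := by
  have hdet : IsUnit (Matrix.vandermonde v) :=
    (Matrix.isUnit_iff_isUnit_det _).2 (Matrix.det_vandermonde_ne_zero_iff.2 hv).isUnit
  obtain ⟨c, hc⟩ := (Matrix.vecMul_surjective_iff_isUnit.2 hdet)
    (fun j : Fin (n + 1) => if (j : ℕ) = 2 then 1 else 0)
  refine ⟨c, fun j hj => ?_⟩
  simpa [Matrix.vecMul, dotProduct, Matrix.vandermonde_apply] using
    congrFun hc ⟨j, Finset.mem_range.1 hj⟩

/-- Taylor's formula in both directions, with a bound on the remainder. -/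
lemma abs_sub_taylor_le {g : ℝ → ℝ} (hg : ContDiff ℝ (⊤ : ℕ∞) g) {n : ℕ} {M : ℝ}
    (hM : ∀ x, |iteratedDeriv (n + 1) g x| ≤ M) (x : ℝ) {t : ℝ} (ht : t ≠ 0) :
    |g (x + t) - ∑ j ∈ Finset.range (n + 1), ((j.factorial : ℝ)⁻¹ * t ^ j) * iteratedDeriv j g x|
      ≤ M * |t| ^ (n + 1) := by
  have hne : x ≠ x + t := by simpa using ht
  obtain ⟨y, -, hy⟩ := taylor_mean_remainder_lagrange_iteratedDeriv (n := n) hne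
    ((hg.of_le (by exact_mod_cast le_top)).contDiffOn)
  rw [taylor_within_apply] at hy
  have hsum : ∑ j ∈ Finset.range (n + 1), ((j.factorial : ℝ)⁻¹ * (x + t - x) ^ j) •
      iteratedDerivWithin j g (uIcc x (x + t)) x =
      ∑ j ∈ Finset.range (n + 1), ((j.factorial : ℝ)⁻¹ * t ^ j) * iteratedDeriv j g x := by
    refine Finset.sum_congr rfl fun j _ => ?_
    rw [iteratedDerivWithin_eq_iteratedDeriv (uniqueDiffOn_uIcc hne)
      ((hg.of_le (by exact_mod_cast le_top)).contDiffAt) left_mem_uIcc]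
    simp
  rw [hsum, add_sub_cancel_left] at hy
  rw [hy, abs_div, abs_mul, abs_pow, Nat.abs_cast]
  have hM0 : 0 ≤ M := (abs_nonneg _).trans (hM x)
  calc _ ≤ |iteratedDeriv (n + 1) g y| * |t| ^ (n + 1) :=
        div_le_self (by positivity)
          (by exact_mod_cast Nat.one_le_iff_ne_zero.2 (Nat.factorial_ne_zero _))
    _ ≤ _ := by gcongr; exact hM y

/-- A Landau–Kolmogorov type estimate of the second derivative on an interval. -/
lemma exists_abs_deriv_deriv_le (n : ℕ) (hn : 2 ≤ n) :
    ∃ K : ℝ, 0 ≤ K ∧ ∀ g : ℝ → ℝ, ContDiff ℝ (⊤ : ℕ∞) g → ∀ M : ℝ,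
      (∀ x, |iteratedDeriv (n + 1) g x| ≤ M) → ∀ a b A h x : ℝ, x ∈ Icc a b → 0 < h → h ≤ b - a →
      (∀ y ∈ Icc a b, |g y| ≤ A) → |deriv (deriv g) x| * h ^ 2 ≤ K * (A + M * h ^ (n + 1)) := by
  let v : Fin (n + 1) → ℝ := fun i => ((i : ℕ) + 1 : ℝ) / (n + 1)
  have hv : Function.Injective v := by
    intro i j hij
    have hn' : (n + 1 : ℝ) ≠ 0 := by positivity
    have : ((i : ℕ) + 1 : ℝ) = (j : ℕ) + 1 := by
      simpa [v, div_left_inj' hn'] using hij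
    exact Fin.ext (by exact_mod_cast add_right_cancel this)
  have hv0 : ∀ i, 0 < v i := fun i => by positivity
  have hv1 : ∀ i, v i ≤ 1 := fun i => by
    refine (div_le_one (by positivity)).2 ?_
    have : ((i : ℕ) : ℝ) ≤ n := by exact_mod_cast Nat.lt_succ_iff.1 i.2
    linarith
  obtain ⟨c, hc⟩ := exists_coeff_sum_mul_pow_eq n v hv
  refine ⟨8 * ∑ i, |c i|, by positivity, ?_⟩
  intro g hg M hM a b A h x hx hh hhb hA
  have hM0 : 0 ≤ M := (abs_nonneg _).trans (hM x)
  obtain ⟨s, hs, hmem⟩ : ∃ s : ℝ, |s| = h / 2 ∧ ∀ i, x + s * v i ∈ Icc a b := by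
    rcases le_total x ((a + b) / 2) with h' | h'
    · refine ⟨h / 2, abs_of_pos (by positivity), fun i => ⟨?_, ?_⟩⟩
      · have := hx.1; have := mul_pos hh (hv0 i); linarith
      · have := mul_le_mul_of_nonneg_left (hv1 i) hh.le; linarith
    · refine ⟨-(h / 2), by rw [abs_neg]; exact abs_of_pos (by positivity), fun i => ⟨?_, ?_⟩⟩
      · have := mul_le_mul_of_nonneg_left (hv1 i) hh.le; linarith
      · have := hx.2; have := mul_pos hh (hv0 i); linarith
  have hs0 : s ≠ 0 := by
    rintro rfl
    simp at hs
    linarith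
  set T : Fin (n + 1) → ℝ := fun i =>
    ∑ j ∈ Finset.range (n + 1), ((j.factorial : ℝ)⁻¹ * (s * v i) ^ j) * iteratedDeriv j g x with hT
  have hsumT : ∑ i, c i * T i = s ^ 2 / 2 * deriv (deriv g) x := by
    simp only [hT, Finset.mul_sum]
    rw [Finset.sum_comm]
    have : ∀ j ∈ Finset.range (n + 1),
        ∑ i, c i * (((j.factorial : ℝ)⁻¹ * (s * v i) ^ j) * iteratedDeriv j g x) =
        if j = 2 then (j.factorial : ℝ)⁻¹ * s ^ j * iteratedDeriv j g x else 0 := by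
      intro j hj
      have : ∑ i, c i * (((j.factorial : ℝ)⁻¹ * (s * v i) ^ j) * iteratedDeriv j g x) =
        ((j.factorial : ℝ)⁻¹ * s ^ j * iteratedDeriv j g x) * ∑ i, c i * v i ^ j := by
        rw [Finset.mul_sum]
        exact Finset.sum_congr rfl fun i _ => by rw [mul_pow]; ring
      rw [this, hc j hj]
      simp
    rw [Finset.sum_congr rfl this, Finset.sum_ite_eq' (Finset.range (n + 1)) 2,
      if_pos (Finset.mem_range.2 (by omega))]
    simp only [Nat.factorial, iteratedDeriv_succ, iteratedDeriv_zero]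
    push_cast
    ring
  have hbound : ∀ i, |T i| ≤ A + M * h ^ (n + 1) := by
    intro i
    have h1 := abs_sub_taylor_le hg hM x (mul_ne_zero hs0 (hv0 i).ne')
    have h2 := hA _ (hmem i)
    have h3 : |s * v i| ≤ h := by
      rw [abs_mul, hs, abs_of_pos (hv0 i)]
      have := mul_le_mul_of_nonneg_left (hv1 i) hh.le
      linarith
    have h4 : M * |s * v i| ^ (n + 1) ≤ M * h ^ (n + 1) := by gcongr
    have h5 : |T i| ≤ |g (x + s * v i)| + |g (x + s * v i) - T i| := by
      have := abs_sub (g (x + s * v i)) (g (x + s * v i) - T i)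
      simpa using this
    linarith
  have hfin : s ^ 2 / 2 * |deriv (deriv g) x| ≤ (∑ i, |c i|) * (A + M * h ^ (n + 1)) := by
    calc s ^ 2 / 2 * |deriv (deriv g) x| = |∑ i, c i * T i| := by
          rw [hsumT, abs_mul, abs_of_nonneg (by positivity : 0 ≤ s ^ 2 / 2)]
      _ ≤ ∑ i, |c i * T i| := Finset.abs_sum_le_sum_abs _ _
      _ ≤ ∑ i, |c i| * (A + M * h ^ (n + 1)) := by
          refine Finset.sum_le_sum fun i _ => ?_
          rw [abs_mul]
          gcongr
          exact hbound i
      _ = _ := by rw [Finset.sum_mul]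
  have hs2 : s ^ 2 = h ^ 2 / 4 := by
    rw [← sq_abs, hs]; ring
  rw [hs2] at hfin
  linarith

lemma rpow_le_four_rpow_abs_mul_rpow {e y : ℝ} (he : 0 < e) (h1 : e ≤ 4 * y) (h2 : y ≤ 4 * e)
    (s : ℝ) : y ^ s ≤ 4 ^ |s| * e ^ s := by
  have hy : 0 < y := by linarith
  have h : (y / e) ^ s ≤ 4 ^ |s| := by
    rcases le_total 0 s with hs | hs
    · rw [abs_of_nonneg hs]
      exact Real.rpow_le_rpow (by positivity) ((div_le_iff₀ he).2 h2) hs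
    · rw [abs_of_nonpos hs, Real.rpow_neg (by norm_num), ← Real.inv_rpow (by norm_num)]
      refine Real.rpow_le_rpow_of_nonpos (by norm_num) ?_ hs
      rw [le_div_iff₀ he]
      linarith
  rwa [Real.div_rpow hy.le he.le, div_le_iff₀ (by positivity)] at h

/-- The oscillation of `log g` is bounded by its total variation. -/
lemma abs_log_sub_log_le_integral {g : ℝ → ℝ} (hg : ContDiff ℝ 1 g) (hpos : ∀ x, 0 < g x)
    {a b x y : ℝ} (hx : x ∈ Icc a b) (hy : y ∈ Icc a b) :
    |Real.log (g x) - Real.log (g y)| ≤ ∫ t in a..b, |deriv g t| / g t := by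
  wlog hxy : y ≤ x generalizing x y
  · rw [abs_sub_comm]
    exact this hy hx (le_of_not_ge hxy)
  have hc : Continuous fun t => deriv g t / g t :=
    (hg.continuous_deriv le_rfl).div hg.continuous fun t => (hpos t).ne'
  have hc' : Continuous fun t => |deriv g t| / g t :=
    (hg.continuous_deriv le_rfl).abs.div hg.continuous fun t => (hpos t).ne'
  have h1 : ∫ t in y..x, deriv g t / g t = Real.log (g x) - Real.log (g y) :=
    intervalIntegral.integral_eq_sub_of_hasDerivAt (f := fun t => Real.log (g t))
      (fun t _ => ((hg.differentiable one_ne_zero t).hasDerivAt).log (hpos t).ne')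
      (hc.intervalIntegrable _ _)
  rw [← h1]
  calc |∫ t in y..x, deriv g t / g t| ≤ ∫ t in y..x, |deriv g t / g t| :=
        intervalIntegral.abs_integral_le_integral_abs hxy
    _ = ∫ t in y..x, |deriv g t| / g t := by
        simp only [abs_div, abs_of_pos (hpos _)]
    _ ≤ ∫ t in a..b, |deriv g t| / g t :=
        intervalIntegral.integral_mono_interval hy.1 hxy hx.2
          (Eventually.of_forall fun t => div_nonneg (abs_nonneg _) (hpos t).le)
          (hc'.intervalIntegrable _ _)

/-- Jensen's inequality for powers on an interval. -/
lemma rpow_integral_mul_rpow_le {u : ℝ → ℝ} (hu : Continuous u) (hu0 : ∀ x, 0 ≤ u x) {p a b : ℝ}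
    (hp : 1 ≤ p) (hab : a < b) (hV : 0 < ∫ x in a..b, u x) :
    (∫ x in a..b, u x) ^ p * ((b - a) ^ (-p) * (b - a)) ≤ ∫ x in a..b, u x ^ p := by
  set V := ∫ x in a..b, u x with hVdef
  have hρ : 0 < b - a := by linarith
  set l := V / (b - a) with hl
  have hl0 : 0 < l := by positivity
  have hpt : ∀ x, l ^ p * (1 - p) + l ^ p * p / l * u x ≤ u x ^ p := by
    intro x
    have h := one_add_mul_self_le_rpow_one_add (s := u x / l - 1)
      (by have := div_nonneg (hu0 x) hl0.le; linarith) hp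
    rw [add_sub_cancel, Real.div_rpow (hu0 x) hl0.le, le_div_iff₀ (by positivity)] at h
    refine le_trans (le_of_eq ?_) h
    field_simp
    ring
  have hci : Continuous fun x => u x ^ p := hu.rpow_const fun _ => Or.inr (by linarith)
  have hcl : Continuous fun x => l ^ p * (1 - p) + l ^ p * p / l * u x := by fun_prop
  have h := intervalIntegral.integral_mono (μ := volume) hab.le (hcl.intervalIntegrable a b)
    (hci.intervalIntegrable a b) hpt
  rw [intervalIntegral.integral_add (continuous_const.intervalIntegrable (μ := volume) a b)
      ((hu.const_mul _).intervalIntegrable a b),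
    intervalIntegral.integral_const, intervalIntegral.integral_const_mul, ← hVdef] at h
  refine le_trans (le_of_eq ?_) h
  have hVl : V = l * (b - a) := by rw [hl]; field_simp
  have e1 : V ^ p * ((b - a) ^ (-p) * (b - a)) = l ^ p * (b - a) := by
    rw [hl, Real.div_rpow hV.le hρ.le, Real.rpow_neg hρ.le]
    field_simp
  rw [e1, hVl, smul_eq_mul]
  field_simp
  ring

/-- The estimate on an interval where `g` changes by a bounded factor, but not by too little. -/
lemma exists_integral_deriv_deriv_le_of_variation_le (n : ℕ) (hn : 2 ≤ n) {p q : ℝ} (hp : 2 ≤ p)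
    (hpq : p / (n + 1) ≤ p - q) (M G : ℝ) :
    ∃ C : ℝ, 0 ≤ C ∧ ∀ g : ℝ → ℝ, ContDiff ℝ (⊤ : ℕ∞) g → (∀ x, 0 < g x) → (∀ x, g x ≤ G) →
      (∀ x, |iteratedDeriv (n + 1) g x| ≤ M) → ∀ a b : ℝ, a < b →
      Real.log 2 ≤ ∫ x in a..b, |deriv g x| / g x →
      ∫ x in a..b, |deriv g x| / g x ≤ 2 * Real.log 2 →
      ∫ x in a..b, |deriv (deriv g) x| ^ (p / 2) * g x ^ (p / 2 - q) ≤
        C * ∫ x in a..b, (|deriv g x| ^ p * g x ^ (-q) + 1) := by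
  obtain ⟨K, hK, hLandau⟩ := exists_abs_deriv_deriv_le n hn
  have hlog : 0 < Real.log 2 := Real.log_pos (by norm_num)
  set m := |M| with hm
  set K₁ := (K * (4 + m)) ^ (p / 2) * 4 ^ |p / 2 - q| with hK₁
  set C₁ := 4 ^ |q - p| * (Real.log 2 ^ p)⁻¹ with hC₁
  set C₂ := |G| ^ (p - q - p / (n + 1)) with hC₂
  have hm0 : 0 ≤ m := abs_nonneg M
  have hK₁0 : 0 ≤ K₁ := by positivity
  have hC₁0 : 0 ≤ C₁ := by positivity
  have hC₂0 : 0 ≤ C₂ := by positivity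
  refine ⟨K₁ * (C₁ + C₂), by positivity, ?_⟩
  intro g hg hpos hG hM a b hab hV1 hV2
  have hp0 : 0 < p := by linarith
  have hρ : 0 < b - a := by linarith
  set e := g a with he
  have he0 : 0 < e := hpos a
  have hosc : ∀ x ∈ Icc a b, e ≤ 4 * g x ∧ g x ≤ 4 * e := by
    intro x hx
    have h := (abs_log_sub_log_le_integral (hg.of_le (by exact_mod_cast le_top)) hpos hx
      (left_mem_Icc.2 hab.le)).trans hV2
    rw [abs_le] at h
    have h4 : 2 * Real.log 2 = Real.log 4 := by
      rw [show (4 : ℝ) = 2 ^ 2 by norm_num, Real.log_pow]; norm_num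
    rw [h4] at h
    constructor
    · rw [← Real.log_le_log_iff he0 (by have := hpos x; positivity),
        Real.log_mul (by norm_num) (hpos x).ne']
      linarith
    · rw [← Real.log_le_log_iff (hpos x) (by positivity), Real.log_mul (by norm_num) he0.ne']
      linarith
  set h := min (b - a) (e ^ ((1 : ℝ) / (n + 1))) with hh
  have hh0 : 0 < h := lt_min hρ (by positivity)
  have hhe : h ^ (n + 1) ≤ e := by
    calc h ^ (n + 1) ≤ (e ^ ((1 : ℝ) / (n + 1))) ^ (n + 1) := by gcongr; exact min_le_right _ _
      _ = e := by
        rw [← Real.rpow_natCast, ← Real.rpow_mul he0.le]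
        push_cast
        rw [one_div_mul_cancel (by positivity), Real.rpow_one]
  have hhp : h ^ (-p) ≤ (b - a) ^ (-p) + e ^ (-(p / (n + 1))) := by
    rcases min_choice (b - a) (e ^ ((1 : ℝ) / (n + 1))) with h' | h'
    · rw [hh, h']
      have : 0 ≤ e ^ (-(p / (n + 1))) := by positivity
      linarith
    · rw [hh, h', ← Real.rpow_mul he0.le, show (1 : ℝ) / (n + 1) * -p = -(p / (n + 1)) by ring]
      have : 0 ≤ (b - a) ^ (-p) := by positivity
      linarith
  have hpt : ∀ x ∈ Icc a b, |deriv (deriv g) x| ^ (p / 2) * g x ^ (p / 2 - q) ≤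
      K₁ * (e ^ (p - q) * (b - a) ^ (-p) + C₂) := by
    intro x hx
    have h1 := hLandau g hg m (fun y => (hM y).trans (le_abs_self M)) a b (4 * e) h x hx hh0
      (min_le_left _ _) (fun y hy => by rw [abs_of_pos (hpos y)]; exact (hosc y hy).2)
    have h2 : |deriv (deriv g) x| ≤ (K * (4 + m)) * e * (h ^ 2)⁻¹ := by
      rw [← div_eq_mul_inv, le_div_iff₀ (by positivity)]
      refine h1.trans ?_
      rw [mul_assoc]
      refine mul_le_mul_of_nonneg_left ?_ hK
      have := mul_le_mul_of_nonneg_left hhe hm0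
      linarith
    have h3 : |deriv (deriv g) x| ^ (p / 2) ≤ (K * (4 + m)) ^ (p / 2) * e ^ (p / 2) * h ^ (-p) := by
      refine (Real.rpow_le_rpow (abs_nonneg _) h2 (by positivity)).trans (le_of_eq ?_)
      rw [Real.mul_rpow (by positivity) (by positivity), Real.mul_rpow (by positivity) he0.le,
        Real.inv_rpow (by positivity), ← Real.rpow_natCast, ← Real.rpow_mul hh0.le,
        Real.rpow_neg hh0.le]
      congr 3
      push_cast
      ring
    have h4 := rpow_le_four_rpow_abs_mul_rpow he0 (hosc x hx).1 (hosc x hx).2 (p / 2 - q)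
    have h5 : e ^ (p - q) * e ^ (-(p / (n + 1))) ≤ C₂ := by
      rw [← Real.rpow_add he0]
      exact Real.rpow_le_rpow he0.le ((hG a).trans (le_abs_self G)) (by linarith)
    calc _ ≤ ((K * (4 + m)) ^ (p / 2) * e ^ (p / 2) * h ^ (-p)) *
          (4 ^ |p / 2 - q| * e ^ (p / 2 - q)) :=
          mul_le_mul h3 h4 (Real.rpow_nonneg (hpos x).le _) (by positivity)
      _ = K₁ * ((e ^ (p / 2) * e ^ (p / 2 - q)) * h ^ (-p)) := by rw [hK₁]; ring
      _ = K₁ * (e ^ (p - q) * h ^ (-p)) := by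
          rw [← Real.rpow_add he0, show p / 2 + (p / 2 - q) = p - q by ring]
      _ ≤ K₁ * (e ^ (p - q) * ((b - a) ^ (-p) + e ^ (-(p / (n + 1))))) := by gcongr
      _ ≤ _ := by
          rw [mul_add (e ^ (p - q))]
          gcongr
  have hc0 := hg.continuous
  have hc1 : Continuous (deriv g) := hg.continuous_deriv (by exact_mod_cast le_top)
  have hcq : Continuous fun x => |deriv g x| ^ p * g x ^ (-q) :=
    (hc1.abs.rpow_const fun _ => Or.inr hp0.le).mul (hc0.rpow_const fun x => Or.inl (hpos x).ne')
  have hcu : Continuous fun x => |deriv g x| / g x := hc1.abs.div hc0 fun x => (hpos x).ne'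
  have hJ : e ^ (p - q) * ((b - a) ^ (-p) * (b - a)) ≤
      C₁ * ∫ x in a..b, |deriv g x| ^ p * g x ^ (-q) := by
    have h1 := rpow_integral_mul_rpow_le hcu (fun x => div_nonneg (abs_nonneg _) (hpos x).le)
      (p := p) (by linarith) hab (hlog.trans_le hV1)
    have h2 : Real.log 2 ^ p * ((b - a) ^ (-p) * (b - a)) ≤
        ∫ x in a..b, (|deriv g x| / g x) ^ p := by
      refine le_trans ?_ h1
      gcongr
    have h3 : ∫ x in a..b, (|deriv g x| / g x) ^ p ≤
        ∫ x in a..b, 4 ^ |q - p| * e ^ (q - p) * (|deriv g x| ^ p * g x ^ (-q)) := by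
      refine intervalIntegral.integral_mono_on hab.le
        ((hcu.rpow_const fun _ => Or.inr hp0.le).intervalIntegrable _ _)
        ((hcq.const_mul _).intervalIntegrable _ _) fun x hx => ?_
      have h4 := rpow_le_four_rpow_abs_mul_rpow he0 (hosc x hx).1 (hosc x hx).2 (q - p)
      calc (|deriv g x| / g x) ^ p = g x ^ (q - p) * (|deriv g x| ^ p * g x ^ (-q)) := by
            rw [Real.div_rpow (abs_nonneg _) (hpos x).le, mul_left_comm,
              ← Real.rpow_add (hpos x), show q - p + -q = -p by ring, Real.rpow_neg (hpos x).le,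
              div_eq_mul_inv]
        _ ≤ _ := by
            have : 0 ≤ g x ^ (-q) := Real.rpow_nonneg (hpos x).le _
            gcongr
    rw [intervalIntegral.integral_const_mul] at h3
    have h5 := h2.trans h3
    have h6 : e ^ (p - q) * e ^ (q - p) = 1 := by
      rw [← Real.rpow_add he0, show p - q + (q - p) = 0 by ring, Real.rpow_zero]
    have h7 : 0 < Real.log 2 ^ p := by positivity
    calc e ^ (p - q) * ((b - a) ^ (-p) * (b - a))
        = (Real.log 2 ^ p)⁻¹ * e ^ (p - q) * (Real.log 2 ^ p * ((b - a) ^ (-p) * (b - a))) := by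
          field_simp
      _ ≤ (Real.log 2 ^ p)⁻¹ * e ^ (p - q) * (4 ^ |q - p| * e ^ (q - p) *
          ∫ x in a..b, |deriv g x| ^ p * g x ^ (-q)) := by gcongr
      _ = (e ^ (p - q) * e ^ (q - p)) * (C₁ * ∫ x in a..b, |deriv g x| ^ p * g x ^ (-q)) := by
          rw [hC₁]; ring
      _ = _ := by rw [h6, one_mul]
  have hint : ∫ x in a..b, |deriv (deriv g) x| ^ (p / 2) * g x ^ (p / 2 - q) ≤
      ∫ _x in a..b, K₁ * (e ^ (p - q) * (b - a) ^ (-p) + C₂) := by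
    have hc2 : Continuous (deriv (deriv g)) :=
      ((contDiff_infty_iff_deriv (f := g)).1 hg).2.continuous_deriv (by exact_mod_cast le_top)
    refine intervalIntegral.integral_mono_on hab.le (Continuous.intervalIntegrable ?_ _ _)
      (by simp) hpt
    exact (hc2.abs.rpow_const fun _ => Or.inr (by positivity)).mul
      (hc0.rpow_const fun x => Or.inl (hpos x).ne')
  refine hint.trans ?_
  rw [intervalIntegral.integral_const, intervalIntegral.integral_add (hcq.intervalIntegrable _ _)
    (by simp), intervalIntegral.integral_const, smul_eq_mul, smul_eq_mul, mul_one]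
  have hI : 0 ≤ ∫ x in a..b, |deriv g x| ^ p * g x ^ (-q) :=
    intervalIntegral.integral_nonneg hab.le fun x _ =>
      mul_nonneg (by positivity) (Real.rpow_nonneg (hpos x).le _)
  calc (b - a) * (K₁ * (e ^ (p - q) * (b - a) ^ (-p) + C₂))
      = K₁ * (e ^ (p - q) * ((b - a) ^ (-p) * (b - a)) + C₂ * (b - a)) := by ring
    _ ≤ K₁ * (C₁ * (∫ x in a..b, |deriv g x| ^ p * g x ^ (-q)) + C₂ * (b - a)) := by gcongr
    _ ≤ K₁ * ((C₁ + C₂) * ((∫ x in a..b, |deriv g x| ^ p * g x ^ (-q)) + (b - a))) := by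
        have h1 := mul_nonneg hC₁0 hρ.le
        have h2 := mul_nonneg hC₂0 hI
        gcongr
        linarith
    _ = _ := by ring

/-- Chopping an interval into pieces on which `log g` has controlled variation. -/
lemma exists_integral_deriv_deriv_le (n : ℕ) (hn : 2 ≤ n) {p q : ℝ} (hp : 2 ≤ p)
    (hpq : p / (n + 1) ≤ p - q) (M G : ℝ) :
    ∃ C : ℝ, 0 ≤ C ∧ ∀ g : ℝ → ℝ, ContDiff ℝ (⊤ : ℕ∞) g → (∀ x, 0 < g x) → (∀ x, g x ≤ G) →
      (∀ x, |iteratedDeriv (n + 1) g x| ≤ M) → ∀ a b : ℝ, a < b →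
      Real.log 2 ≤ ∫ x in a..b, |deriv g x| / g x →
      ∫ x in a..b, |deriv (deriv g) x| ^ (p / 2) * g x ^ (p / 2 - q) ≤
        C * ∫ x in a..b, (|deriv g x| ^ p * g x ^ (-q) + 1) := by
  obtain ⟨C, hC, hbase⟩ := exists_integral_deriv_deriv_le_of_variation_le n hn hp hpq M G
  have hlog : 0 < Real.log 2 := Real.log_pos (by norm_num)
  refine ⟨C, hC, fun g hg hpos hG hM => ?_⟩
  have hc0 := hg.continuous
  have hc1 : Continuous (deriv g) := hg.continuous_deriv (by exact_mod_cast le_top)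
  have hc2 : Continuous (deriv (deriv g)) :=
    ((contDiff_infty_iff_deriv (f := g)).1 hg).2.continuous_deriv (by exact_mod_cast le_top)
  have hcu : Continuous fun x => |deriv g x| / g x := hc1.abs.div hc0 fun x => (hpos x).ne'
  have hcl : Continuous fun x => |deriv (deriv g) x| ^ (p / 2) * g x ^ (p / 2 - q) :=
    (hc2.abs.rpow_const fun _ => Or.inr (by positivity)).mul
      (hc0.rpow_const fun x => Or.inl (hpos x).ne')
  have hcr : Continuous fun x => |deriv g x| ^ p * g x ^ (-q) + 1 :=
    ((hc1.abs.rpow_const fun _ => Or.inr (by positivity)).mul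
      (hc0.rpow_const fun x => Or.inl (hpos x).ne')).add continuous_const
  have hind : ∀ N : ℕ, ∀ a b : ℝ, a < b → Real.log 2 ≤ ∫ x in a..b, |deriv g x| / g x →
      ∫ x in a..b, |deriv g x| / g x ≤ (N + 2) * Real.log 2 →
      ∫ x in a..b, |deriv (deriv g) x| ^ (p / 2) * g x ^ (p / 2 - q) ≤
        C * ∫ x in a..b, (|deriv g x| ^ p * g x ^ (-q) + 1) := by
    intro N
    induction N with
    | zero =>
      intro a b hab h1 h2
      exact hbase g hg hpos hG hM a b hab h1 (by simpa using h2)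
    | succ N ih =>
      intro a b hab h1 h2
      by_cases h3 : ∫ x in a..b, |deriv g x| / g x ≤ 2 * Real.log 2
      · exact hbase g hg hpos hG hM a b hab h1 h3
      have hcont : Continuous fun c => ∫ x in a..c, |deriv g x| / g x :=
        intervalIntegral.continuous_primitive (fun _ _ => hcu.intervalIntegrable _ _) a
      obtain ⟨c, hc, hVc⟩ := intermediate_value_Icc hab.le hcont.continuousOn
        (show Real.log 2 ∈ Icc _ _ from ⟨by simpa using hlog.le, h1⟩)
      simp only at hVc
      have hac : a < c := hc.1.lt_of_ne (by
        rintro rfl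
        simp at hVc
        linarith)
      have hadd := intervalIntegral.integral_add_adjacent_intervals
        (hcu.intervalIntegrable a c (μ := volume)) (hcu.intervalIntegrable c b)
      rw [hVc] at hadd
      have hcb : c < b := hc.2.lt_of_ne (by
        rintro rfl
        simp at hadd
        linarith)
      push_cast at h2
      have i1 := hbase g hg hpos hG hM a c hac hVc.ge (by linarith)
      have i2 := ih c b hcb (by linarith) (by linarith)
      rw [← intervalIntegral.integral_add_adjacent_intervals
          (hcl.intervalIntegrable a c) (hcl.intervalIntegrable c b),
        ← intervalIntegral.integral_add_adjacent_intervals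
          (hcr.intervalIntegrable a c) (hcr.intervalIntegrable c b), mul_add]
      exact add_le_add i1 i2
  intro a b hab h1
  obtain ⟨N, hN⟩ := exists_nat_ge ((∫ x in a..b, |deriv g x| / g x) / Real.log 2)
  rw [div_le_iff₀ hlog] at hN
  exact hind N a b hab h1 (by linarith)

lemma hasDerivAt_abs_rpow_mul_self {p : ℝ} (hp : 2 ≤ p) (x : ℝ) :
    HasDerivAt (fun s : ℝ => |s| ^ (p - 2) * s) ((p - 1) * |x| ^ (p - 2)) x := by
  rcases hp.eq_or_lt with rfl | hp'
  · simpa [show (2 : ℝ) - 1 = 1 by norm_num] using hasDerivAt_id' x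
  rcases eq_or_ne x 0 with rfl | hx
  · rw [hasDerivAt_iff_tendsto_slope_zero]
    have hz : p - 2 ≠ 0 := by linarith
    have hc : Continuous fun t : ℝ => |t| ^ (p - 2) :=
      continuous_abs.rpow_const fun _ => Or.inr (by linarith)
    have := (hc.tendsto 0).mono_left (nhdsWithin_le_nhds (s := {0}ᶜ))
    simp only [abs_zero, Real.zero_rpow hz, mul_zero] at this ⊢
    refine this.congr' ?_
    filter_upwards [self_mem_nhdsWithin] with t ht
    have ht : t ≠ 0 := ht
    simp
    field_simp
  · have h1 : HasDerivAt (fun s : ℝ => |s| ^ (p - 2)) ((p - 2) * |x| ^ (p - 2) / x) x := by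
      have h2 := (hasDerivAt_abs hx).rpow_const (p := p - 2) (Or.inl (abs_ne_zero.2 hx))
      convert h2 using 1
      rw [Real.rpow_sub_one (abs_ne_zero.2 hx)]
      rcases lt_or_gt_of_ne hx with h | h
      · simp [abs_of_neg h, sign_neg h]; field_simp; ring
      · simp [abs_of_pos h, sign_pos h]; field_simp
    refine (h1.mul (hasDerivAt_id' x)).congr_deriv ?_
    field_simp
    ring

/-- If `|f'| / f ^ θ` and `√(f |f''|) / f ^ θ` both belong to `L ^ p`, the inequality follows from
integrating by parts against the regularized weight `f * (f + ε) ^ (-θ p)`. -/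
lemma power_weight_inequality_of_integrable
    {p θ : ℝ} (hp : 2 ≤ p) (hθ : 1 < θ * p)
    {f : ℝ → ℝ} (hf : ContDiff ℝ (⊤ : ℕ∞) f) (hnn : ∀ x, 0 ≤ f x)
    (hsupp : HasCompactSupport (deriv f))
    (hX : IntegrableOn (fun x => (|deriv f x| / f x ^ θ) ^ p) {x : ℝ | 0 < f x})
    (hY : IntegrableOn (fun x => (Real.sqrt (f x * |deriv (deriv f) x|) / f x ^ θ) ^ p)
      {x : ℝ | 0 < f x}) :
    ∫ x in {x : ℝ | 0 < f x}, (|deriv f x| / f x ^ θ) ^ p ≤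
      ((p - 1) / (θ * p - 1)) ^ (p / 2) *
        ∫ x in {x : ℝ | 0 < f x},
          (Real.sqrt (f x * |deriv (deriv f) x|) / f x ^ θ) ^ p := by
  set q := θ * p with hq
  set S := {x : ℝ | 0 < f x} with hS
  have hSm : MeasurableSet S := measurableSet_lt measurable_const hf.continuous.measurable
  have hd : ∀ x, HasDerivAt f (deriv f x) x := fun x =>
    (hf.differentiable (by simp)).differentiableAt.hasDerivAt
  have hf1 : ContDiff ℝ (⊤ : ℕ∞) (deriv f) := ((contDiff_infty_iff_deriv (f := f)).1 hf).2
  have hdd : ∀ x, HasDerivAt (deriv f) (deriv (deriv f) x) x := fun x =>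
    (hf1.differentiable (by simp)).differentiableAt.hasDerivAt
  have hc0 := hf.continuous
  have hc1 := hf1.continuous
  have hc2 : Continuous (deriv (deriv f)) :=
    ((contDiff_infty_iff_deriv (f := deriv f)).1 hf1).2.continuous
  have hzero : ∀ x, f x = 0 → deriv f x = 0 := fun x hx =>
    IsLocalMin.deriv_eq_zero (Eventually.of_forall fun y => by rw [hx]; exact hnn y)
  have hp0 : 0 < p := by linarith
  set c := (q - 1) / (p - 1) with hc
  have hcpos : 0 < c := div_pos (by linarith) (by linarith)
  set X := fun x => |deriv f x| / f x ^ θ with hXdef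
  set Y := fun x => Real.sqrt (f x * |deriv (deriv f) x|) / f x ^ θ with hYdef
  set A := ∫ x in S, X x ^ p with hA
  set B := ∫ x in S, Y x ^ p with hB
  set L : ℝ → ℝ → ℝ := fun ε x =>
    |deriv f x| ^ p * (f x + ε) ^ (-q) * (q * (f x / (f x + ε)) - 1) with hL
  set R : ℝ → ℝ → ℝ := fun ε x =>
    (p - 1) * |deriv f x| ^ (p - 2) * deriv (deriv f) x * (f x * (f x + ε) ^ (-q)) with hR
  have hcont1 : Continuous fun x => |deriv f x| ^ (p - 2) :=
    hc1.abs.rpow_const fun _ => Or.inr (by linarith)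
  have hcontp : Continuous fun x => |deriv f x| ^ p :=
    hc1.abs.rpow_const fun _ => Or.inr (by linarith)
  have hcw : ∀ ε > 0, Continuous fun x => (f x + ε) ^ (-q) := fun ε hε =>
    (hc0.add continuous_const).rpow_const fun x => Or.inl (add_pos_of_nonneg_of_pos (hnn x) hε).ne'
  have hLc : ∀ ε > 0, Continuous (L ε) := fun ε hε =>
    (hcontp.mul (hcw ε hε)).mul ((continuous_const.mul (hc0.div (hc0.add continuous_const)
      fun x => (add_pos_of_nonneg_of_pos (hnn x) hε).ne')).sub continuous_const)
  have hRc : ∀ ε > 0, Continuous (R ε) := fun ε hε =>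
    ((continuous_const.mul hcont1).mul hc2).mul (hc0.mul (hcw ε hε))
  have hLi : ∀ ε > 0, Integrable (L ε) := fun ε hε => by
    refine (hLc ε hε).integrable_of_hasCompactSupport (hsupp.mono ?_)
    intro x hx h0
    refine hx ?_
    simp [hL, h0, Real.zero_rpow hp0.ne']
  have hRi : ∀ ε > 0, Integrable (R ε) := fun ε hε => by
    refine (hRc ε hε).integrable_of_hasCompactSupport (hsupp.deriv.mono ?_)
    intro x hx h0
    refine hx ?_
    simp [hR, h0]
  have habs : ∀ x, |deriv f x| ^ (p - 2) * deriv f x * deriv f x = |deriv f x| ^ p := by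
    intro x
    rw [mul_assoc, ← abs_mul_abs_self, ← sq, ← Real.rpow_natCast,
      ← Real.rpow_add' (abs_nonneg _) (by push_cast; linarith)]
    congr 1; push_cast; ring
  have hibp : ∀ ε > 0, ∫ x, L ε x = ∫ x, R ε x := by
    intro ε hε
    have hder : ∀ x, HasDerivAt
        (fun x => (|deriv f x| ^ (p - 2) * deriv f x) * (f x * (f x + ε) ^ (-q)))
        (R ε x - L ε x) x := by
      intro x
      have hpos : 0 < f x + ε := by have := hnn x; positivity
      have h1 := (hasDerivAt_abs_rpow_mul_self hp (deriv f x)).comp x (hdd x)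
      have h2 := (hd x).mul (((hd x).add_const ε).rpow_const (p := -q) (Or.inl hpos.ne'))
      refine (h1.mul h2).congr_deriv ?_
      simp only [hL, hR, Function.comp_apply, Pi.mul_apply, ← habs x, Real.rpow_sub_one hpos.ne']
      field_simp
      ring
    have h0 := integral_eq_zero_of_hasDerivAt_of_integrable hder ((hRi ε hε).sub (hLi ε hε))
      (by
        refine Continuous.integrable_of_hasCompactSupport
          ((hcont1.mul hc1).mul (hc0.mul (hcw ε hε))) (hsupp.mono ?_)
        intro x hx h0
        exact hx (by simp [h0]))
    rw [integral_sub (hRi ε hε) (hLi ε hε)] at h0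
    linarith
  have hLS : ∀ ε, ∫ x in S, L ε x = ∫ x, L ε x := fun ε =>
    setIntegral_eq_integral_of_forall_compl_eq_zero fun x hx => by
      have : f x = 0 := le_antisymm (not_lt.1 hx) (hnn x)
      simp [hL, hzero x this, Real.zero_rpow hp0.ne']
  have hRS : ∀ ε, ∫ x in S, R ε x = ∫ x, R ε x := fun ε =>
    setIntegral_eq_integral_of_forall_compl_eq_zero fun x hx => by
      have : f x = 0 := le_antisymm (not_lt.1 hx) (hnn x)
      simp [hR, this]
  have hXp : ∀ x ∈ S, X x ^ p = |deriv f x| ^ p * f x ^ (-q) := by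
    intro x hx
    have hx : 0 < f x := hx
    simp only [hXdef]
    rw [Real.div_rpow (abs_nonneg _) (by positivity), ← Real.rpow_mul hx.le, ← hq,
      Real.rpow_neg hx.le, div_eq_mul_inv]
  set W := fun x => (p - 1) * (c * ((1 - 2 / p) * X x ^ p + 2 / p * ((c⁻¹) ^ (p / 2) * Y x ^ p)))
    with hW
  have hWi : IntegrableOn W S :=
    (((hX.const_mul _).add ((hY.const_mul _).const_mul _)).const_mul c).const_mul _
  have hRW : ∀ ε > 0, ∀ x ∈ S, R ε x ≤ W x := by
    intro ε hε x hx
    have hx : 0 < f x := hx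
    have hX0 : 0 ≤ X x := by simp only [hXdef]; positivity
    have hY0 : 0 ≤ Y x := by simp only [hYdef]; positivity
    have hyoung := Real.geom_mean_le_arith_mean2_weighted (w₁ := 1 - 2 / p) (w₂ := 2 / p)
      (p₁ := X x ^ p) (p₂ := (c⁻¹) ^ (p / 2) * Y x ^ p)
      (by rw [sub_nonneg]; exact (div_le_one hp0).2 hp) (by positivity) (by positivity)
      (by positivity) (by ring)
    have e1 : (X x ^ p) ^ (1 - 2 / p) = X x ^ (p - 2) := by
      rw [← Real.rpow_mul hX0]; congr 1; field_simp
    have e2 : ((c⁻¹) ^ (p / 2) * Y x ^ p) ^ (2 / p) = c⁻¹ * Y x ^ 2 := by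
      rw [Real.mul_rpow (by positivity) (by positivity), ← Real.rpow_mul (by positivity),
        ← Real.rpow_mul hY0, show p / 2 * (2 / p) = 1 by field_simp,
        show p * (2 / p) = ((2 : ℕ) : ℝ) by push_cast; field_simp, Real.rpow_natCast, Real.rpow_one]
    rw [e1, e2] at hyoung
    have e3 : X x ^ (p - 2) * Y x ^ 2 =
        |deriv f x| ^ (p - 2) * |deriv (deriv f) x| * (f x * f x ^ (-q)) := by
      simp only [hXdef, hYdef]
      rw [Real.div_rpow (abs_nonneg _) (by positivity), div_pow, Real.sq_sqrt (by positivity),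
        ← Real.rpow_mul hx.le, ← Real.rpow_natCast (f x ^ θ), ← Real.rpow_mul hx.le,
        Real.rpow_neg hx.le, div_mul_div_comm, ← Real.rpow_add hx,
        show θ * (p - 2) + θ * ((2 : ℕ) : ℝ) = q by push_cast; rw [hq]; ring]
      ring
    have e4 : R ε x ≤ (p - 1) * (X x ^ (p - 2) * Y x ^ 2) := by
      rw [e3]
      simp only [hR]
      have hw : (f x + ε) ^ (-q) ≤ f x ^ (-q) :=
        Real.rpow_le_rpow_of_nonpos hx (by linarith) (by linarith)
      have hp1 : 0 ≤ p - 1 := by linarith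
      calc _ ≤ (p - 1) * |deriv f x| ^ (p - 2) * |deriv (deriv f) x| * (f x * f x ^ (-q)) := by
            have := le_abs_self (deriv (deriv f) x)
            gcongr
        _ = _ := by ring
    refine e4.trans ?_
    refine mul_le_mul_of_nonneg_left ?_ (by linarith)
    calc X x ^ (p - 2) * Y x ^ 2 = c * (X x ^ (p - 2) * (c⁻¹ * Y x ^ 2)) := by field_simp
      _ ≤ _ := by gcongr
  have hWint : ∫ x in S, W x =
      (p - 1) * (c * ((1 - 2 / p) * A + 2 / p * ((c⁻¹) ^ (p / 2) * B))) := by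
    simp only [hW]
    rw [integral_const_mul, integral_const_mul, integral_add (hX.const_mul _)
      ((hY.const_mul _).const_mul _), integral_const_mul, integral_const_mul, integral_const_mul]
  have hle : ∀ ε > 0, ∫ x in S, L ε x ≤ ∫ x in S, W x := by
    intro ε hε
    rw [hLS, hibp ε hε, ← hRS]
    exact setIntegral_mono_on (hRi ε hε).integrableOn hWi hSm (hRW ε hε)
  have hlim : Tendsto (fun n : ℕ => ∫ x in S, L (1 / ((n : ℝ) + 1)) x) atTop
      (𝓝 (∫ x in S, (q - 1) * X x ^ p)) := by
    refine tendsto_integral_of_dominated_convergence (fun x => (q + 1) * X x ^ p)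
      (fun n => (hLc _ (by positivity)).aestronglyMeasurable) (hX.const_mul _) ?_ ?_
    · intro n
      filter_upwards [ae_restrict_mem hSm] with x hx
      have hx0 : 0 < f x := hx
      rw [hXp x hx]
      have hε : (0 : ℝ) < 1 / ((n : ℝ) + 1) := by positivity
      generalize (1 / ((n : ℝ) + 1)) = ε at hε
      have hw : (f x + ε) ^ (-q) ≤ f x ^ (-q) :=
        Real.rpow_le_rpow_of_nonpos hx0 (by linarith) (by linarith)
      have hr0 : 0 ≤ f x / (f x + ε) := by positivity
      have hr1 : f x / (f x + ε) ≤ 1 := (div_le_one (by positivity)).2 (by linarith)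
      have hr2 : |q * (f x / (f x + ε)) - 1| ≤ q + 1 := by
        rw [abs_le]; constructor <;> nlinarith
      simp only [hL, Real.norm_eq_abs]
      rw [abs_mul, abs_of_nonneg (by positivity : 0 ≤ |deriv f x| ^ p * (f x + ε) ^ (-q)), mul_comm]
      gcongr
    · filter_upwards [ae_restrict_mem hSm] with x hx
      have hx0 : 0 < f x := hx
      have hε := tendsto_one_div_add_atTop_nhds_zero_nat (𝕜 := ℝ)
      have h1 : Tendsto (fun n : ℕ => f x + 1 / ((n : ℝ) + 1)) atTop (𝓝 (f x)) := by
        simpa using hε.const_add (f x)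
      have h2 := h1.rpow_const (p := -q) (Or.inl hx0.ne')
      have h3 := (tendsto_const_nhds (x := f x)).div h1 hx0.ne'
      have h4 := (h2.const_mul (|deriv f x| ^ p)).mul ((h3.const_mul q).sub_const 1)
      rw [div_self hx0.ne', mul_one, mul_comm _ (q - 1), ← hXp x hx] at h4
      exact h4
  have hmain : (q - 1) * A ≤ (p - 1) * (c * ((1 - 2 / p) * A + 2 / p * ((c⁻¹) ^ (p / 2) * B))) := by
    rw [← hWint, hA, ← integral_const_mul]
    exact le_of_tendsto' hlim fun n => hle _ (by positivity)
  have hpc : (p - 1) * c = q - 1 := by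
    rw [hc]; field_simp [show p - 1 ≠ 0 by linarith]
  rw [← mul_assoc, hpc] at hmain
  have hmain2 := le_of_mul_le_mul_left hmain (by linarith)
  have hcinv : (p - 1) / (q - 1) = c⁻¹ := by rw [hc, inv_div]
  rw [hcinv]
  have h2p : 0 < 2 / p := by positivity
  refine le_of_mul_le_mul_left ?_ h2p
  linarith

lemma HasCompactSupport.iteratedDeriv {h : ℝ → ℝ} (hh : HasCompactSupport h) (n : ℕ) :
    HasCompactSupport (iteratedDeriv n h) := by
  induction n with
  | zero => simpa using hh
  | succ n ih => simpa only [iteratedDeriv_succ] using ih.deriv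

lemma bddAbove_of_hasCompactSupport_deriv {f : ℝ → ℝ} (hf : ContDiff ℝ 1 f)
    (hsupp : HasCompactSupport (deriv f)) : ∃ G, ∀ x, f x ≤ G := by
  have hc := hf.continuous_deriv le_rfl
  refine ⟨f 0 + ∫ t, ‖deriv f t‖, fun x => ?_⟩
  have h1 : ∫ t in (0 : ℝ)..x, deriv f t = f x - f 0 :=
    intervalIntegral.integral_deriv_eq_sub (fun t _ => hf.differentiable one_ne_zero t)
      (hc.intervalIntegrable _ _)
  have h2 := intervalIntegral.norm_integral_le_integral_norm_uIoc (f := deriv f) (a := 0) (b := x)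
    (μ := volume)
  have h3 : ∫ t in uIoc 0 x, ‖deriv f t‖ ≤ ∫ t, ‖deriv f t‖ :=
    setIntegral_le_integral (hc.integrable_of_hasCompactSupport hsupp).norm
      (Eventually.of_forall fun t => norm_nonneg _)
  rw [h1] at h2
  have h4 := le_abs_self (f x - f 0)
  rw [Real.norm_eq_abs] at h2
  linarith

lemma integral_regularized_weight_le {p θ : ℝ} (hp : 0 < p) (hθ : 0 ≤ θ) {f : ℝ → ℝ}
    (hf : ContDiff ℝ 1 f) (hnn : ∀ x, 0 ≤ f x) (hsupp : HasCompactSupport (deriv f))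
    (hX : IntegrableOn (fun x => (|deriv f x| / f x ^ θ) ^ p) {x : ℝ | 0 < f x})
    {ε : ℝ} (hε : 0 < ε) {a b : ℝ} (hab : a ≤ b) :
    ∫ x in a..b, |deriv f x| ^ p * (f x + ε) ^ (-(θ * p)) ≤
      ∫ x in {x : ℝ | 0 < f x}, (|deriv f x| / f x ^ θ) ^ p := by
  set S := {x : ℝ | 0 < f x} with hS
  have hSm : MeasurableSet S := measurableSet_lt measurable_const hf.continuous.measurable
  have hzero : ∀ x, f x = 0 → deriv f x = 0 := fun x hx =>
    IsLocalMin.deriv_eq_zero (Eventually.of_forall fun y => by rw [hx]; exact hnn y)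
  have hg : ∀ x, 0 < f x + ε := fun x => add_pos_of_nonneg_of_pos (hnn x) hε
  have hc : Continuous fun x => |deriv f x| ^ p * (f x + ε) ^ (-(θ * p)) :=
    ((hf.continuous_deriv le_rfl).abs.rpow_const fun _ => Or.inr hp.le).mul
      ((hf.continuous.add continuous_const).rpow_const fun x => Or.inl (hg x).ne')
  have hi : Integrable fun x => |deriv f x| ^ p * (f x + ε) ^ (-(θ * p)) := by
    refine hc.integrable_of_hasCompactSupport (hsupp.mono fun x hx h0 => hx ?_)
    simp [h0, Real.zero_rpow hp.ne']
  rw [intervalIntegral.integral_of_le hab]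
  calc _ ≤ ∫ x, |deriv f x| ^ p * (f x + ε) ^ (-(θ * p)) :=
        setIntegral_le_integral hi (Eventually.of_forall fun x =>
          mul_nonneg (by positivity) (Real.rpow_nonneg (hg x).le _))
    _ = ∫ x in S, |deriv f x| ^ p * (f x + ε) ^ (-(θ * p)) := by
        refine (setIntegral_eq_integral_of_forall_compl_eq_zero fun x hx => ?_).symm
        have : f x = 0 := le_antisymm (not_lt.1 hx) (hnn x)
        simp [hzero x this, Real.zero_rpow hp.ne']
    _ ≤ _ := by
        refine setIntegral_mono_on hi.integrableOn hX hSm fun x hx => ?_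
        have hx : 0 < f x := hx
        rw [Real.div_rpow (abs_nonneg _) (by positivity), ← Real.rpow_mul hx.le, div_eq_mul_inv,
          ← Real.rpow_neg hx.le]
        refine mul_le_mul_of_nonneg_left ?_ (by positivity)
        exact Real.rpow_le_rpow_of_nonpos hx (by linarith) (by nlinarith)

/-- For `θ ≥ 1` the left-hand side is infinite unless `f` is constant or has no zeros. -/
lemma theta_lt_one_of_integrable {p θ : ℝ} (hp : 1 ≤ p) {f : ℝ → ℝ}
    (hf : ContDiff ℝ 1 f) (hnn : ∀ x, 0 ≤ f x) (hsupp : HasCompactSupport (deriv f))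
    (hX : IntegrableOn (fun x => (|deriv f x| / f x ^ θ) ^ p) {x : ℝ | 0 < f x})
    {z m : ℝ} (hz : f z = 0) (hm : 0 < f m) : θ < 1 := by
  by_contra! hθ
  have hp0 : 0 < p := by linarith
  obtain ⟨G, hG⟩ := bddAbove_of_hasCompactSupport_deriv hf hsupp
  set A := ∫ x in {x : ℝ | 0 < f x}, (|deriv f x| / f x ^ θ) ^ p with hA
  set a := min z m with ha
  set b := max z m with hb
  have hab : a ≤ b := min_le_max
  set B := (b - a) + (G + 1) ^ (θ * p - p) * A with hB
  set ε := min 1 (f m * Real.exp (-(B + 1))) with hε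
  have hε0 : 0 < ε := lt_min one_pos (by positivity)
  have hg : ∀ x, 0 < f x + ε := fun x => add_pos_of_nonneg_of_pos (hnn x) hε0
  have hdg : deriv (fun x => f x + ε) = deriv f := funext fun x => deriv_add_const ε
  have h1 := abs_log_sub_log_le_integral (hf.add contDiff_const) hg (a := a) (b := b)
    (x := m) (y := z) ⟨min_le_right _ _, le_max_right _ _⟩ ⟨min_le_left _ _, le_max_left _ _⟩
  rw [hdg] at h1
  have h2 : B + 1 ≤ Real.log (f m + ε) - Real.log (f z + ε) := by
    have h3 : Real.log ε ≤ Real.log (f m) - (B + 1) := by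
      calc Real.log ε ≤ Real.log (f m * Real.exp (-(B + 1))) :=
            Real.log_le_log hε0 (min_le_right _ _)
        _ = _ := by rw [Real.log_mul hm.ne' (Real.exp_pos _).ne', Real.log_exp]; ring
    have h4 : Real.log (f m) ≤ Real.log (f m + ε) := Real.log_le_log hm (by linarith)
    rw [hz, zero_add]
    linarith
  have hc1 := hf.continuous_deriv le_rfl
  have hcu : Continuous fun x => |deriv f x| / (f x + ε) :=
    hc1.abs.div (hf.continuous.add continuous_const) fun x => (hg x).ne'
  have hcq : Continuous fun x => |deriv f x| ^ p * (f x + ε) ^ (-(θ * p)) :=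
    (hc1.abs.rpow_const fun _ => Or.inr hp0.le).mul
      ((hf.continuous.add continuous_const).rpow_const fun x => Or.inl (hg x).ne')
  have h5 : ∫ x in a..b, |deriv f x| / (f x + ε) ≤
      ∫ x in a..b, (1 + (G + 1) ^ (θ * p - p) * (|deriv f x| ^ p * (f x + ε) ^ (-(θ * p)))) := by
    refine intervalIntegral.integral_mono hab (hcu.intervalIntegrable _ _)
      ((continuous_const.add (hcq.const_mul _)).intervalIntegrable _ _) fun x => ?_
    have hu : 0 ≤ |deriv f x| / (f x + ε) := div_nonneg (abs_nonneg _) (hg x).le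
    have h6 : |deriv f x| / (f x + ε) ≤ 1 + (|deriv f x| / (f x + ε)) ^ p := by
      rcases le_total (|deriv f x| / (f x + ε)) 1 with h | h
      · have := Real.rpow_nonneg hu p
        linarith
      · have := Real.rpow_le_rpow_of_exponent_le h hp
        rw [Real.rpow_one] at this
        linarith
    refine h6.trans (add_le_add le_rfl ?_)
    rw [Real.div_rpow (abs_nonneg _) (hg x).le, div_eq_mul_inv, ← Real.rpow_neg (hg x).le,
      show -p = (θ * p - p) + -(θ * p) by ring, Real.rpow_add (hg x), mul_left_comm]
    have h7 : (f x + ε) ^ (θ * p - p) ≤ (G + 1) ^ (θ * p - p) :=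
      Real.rpow_le_rpow (hg x).le (add_le_add (hG x) (min_le_left _ _)) (by nlinarith)
    exact mul_le_mul_of_nonneg_right h7
      (mul_nonneg (by positivity) (Real.rpow_nonneg (hg x).le _))
  rw [intervalIntegral.integral_add (continuous_const.intervalIntegrable a b)
    ((hcq.const_mul _).intervalIntegrable a b), intervalIntegral.integral_const_mul,
    intervalIntegral.integral_const, smul_eq_mul, mul_one] at h5
  have h8 := integral_regularized_weight_le hp0 (by linarith) hf hnn hsupp hX hε0 hab
  have hG1 : 0 ≤ G + 1 := by have := hnn 0; have := hG 0; linarith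
  have h9 := mul_le_mul_of_nonneg_left h8 (Real.rpow_nonneg hG1 (θ * p - p))
  have h10 := le_abs_self (Real.log (f m + ε) - Real.log (f z + ε))
  linarith

/-- Finiteness of the left-hand side of the inequality implies that of the right-hand side. -/
lemma integrableOn_sqrt_mul_deriv_deriv {p θ : ℝ} (hp : 2 ≤ p) (hθ : 0 ≤ θ) {f : ℝ → ℝ}
    (hf : ContDiff ℝ (⊤ : ℕ∞) f) (hnn : ∀ x, 0 ≤ f x) (hsupp : HasCompactSupport (deriv f))
    (hX : IntegrableOn (fun x => (|deriv f x| / f x ^ θ) ^ p) {x : ℝ | 0 < f x}) :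
    IntegrableOn (fun x => (Real.sqrt (f x * |deriv (deriv f) x|) / f x ^ θ) ^ p)
      {x : ℝ | 0 < f x} := by
  have hp0 : 0 < p := by linarith
  have hf1 : ContDiff ℝ 1 f := hf.of_le (by exact_mod_cast le_top)
  have hfd : ContDiff ℝ (⊤ : ℕ∞) (deriv f) := ((contDiff_infty_iff_deriv (f := f)).1 hf).2
  have hc0 := hf.continuous
  have hc2 : Continuous (deriv (deriv f)) := hfd.continuous_deriv (by exact_mod_cast le_top)
  set S := {x : ℝ | 0 < f x} with hS
  have hSm : MeasurableSet S := measurableSet_lt measurable_const hc0.measurable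
  by_cases hall : ∀ x, 0 < f x
  · refine Integrable.integrableOn (Continuous.integrable_of_hasCompactSupport ?_
      (hsupp.deriv.mono fun x hx h0 => hx ?_))
    · exact ((hc0.mul hc2.abs).sqrt.div (hc0.rpow_const fun x => Or.inl (hall x).ne')
        fun x => (Real.rpow_pos_of_pos (hall x) _).ne').rpow_const fun _ => Or.inr hp0.le
    · simp [h0, Real.zero_rpow hp0.ne']
  push Not at hall
  obtain ⟨z, hz⟩ := hall
  replace hz : f z = 0 := le_antisymm hz (hnn z)
  by_cases hex : ∃ m, 0 < f m
  swap
  · push Not at hex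
    have : S = ∅ := eq_empty_of_forall_notMem fun x hx => absurd hx (hex x).not_gt
    simp [this]
  obtain ⟨m, hm⟩ := hex
  have hθ1 := theta_lt_one_of_integrable (by linarith) hf1 hnn hsupp hX hz hm
  set q := θ * p with hq
  obtain ⟨G, hG⟩ := bddAbove_of_hasCompactSupport_deriv hf1 hsupp
  obtain ⟨n, hn, hpn⟩ : ∃ n : ℕ, 2 ≤ n ∧ p / (n + 1) ≤ p - q := by
    obtain ⟨k, hk⟩ := exists_nat_ge (1 / (1 - θ))
    refine ⟨max 2 k, le_max_left _ _, ?_⟩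
    have h1 : (k : ℝ) ≤ (max 2 k : ℕ) := by exact_mod_cast le_max_right _ _
    rw [div_le_iff₀ (by linarith)] at hk
    rw [div_le_iff₀ (by positivity), hq]
    have h2 : 1 ≤ (1 - θ) * ((max 2 k : ℕ) + 1) := by nlinarith
    nlinarith
  obtain ⟨M, hM⟩ := (hsupp.iteratedDeriv n).exists_bound_of_continuous
    (hfd.continuous_iteratedDeriv n (by exact_mod_cast le_top))
  obtain ⟨C, hC, hmain⟩ := exists_integral_deriv_deriv_le n hn hp hpn M (G + 1)
  obtain ⟨r, hr⟩ := hsupp.isCompact.isBounded.subset_closedBall 0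
  set l := max r (max |z| |m|) + 1 with hl
  have hlr : r < l := (le_max_left _ _).trans_lt (lt_add_one _)
  have hlz : |z| ≤ l := ((le_max_left _ _).trans (le_max_right r _)).trans (lt_add_one _).le
  have hlm : |m| ≤ l := ((le_max_right _ _).trans (le_max_right r _)).trans (lt_add_one _).le
  have hl0 : 0 < l := by
    have : 0 ≤ max r (max |z| |m|) :=
      (abs_nonneg z).trans ((le_max_left _ _).trans (le_max_right r _))
    linarith
  have hout : ∀ x, x ∉ Ioc (-l) l → deriv (deriv f) x = 0 := by
    intro x hx
    by_contra h0
    have h1 := hr (support_deriv_subset h0)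
    rw [mem_closedBall_zero_iff, Real.norm_eq_abs] at h1
    have := abs_le.1 (h1.trans hlr.le)
    have := abs_lt.1 (h1.trans_lt hlr)
    exact hx ⟨this.1, this.2.le⟩
  set A := ∫ x in S, (|deriv f x| / f x ^ θ) ^ p with hA
  set ε : ℕ → ℝ := fun N => min 1 (f m) * (1 / ((N : ℝ) + 1)) with hε
  have hε1 : 0 < min 1 (f m) := lt_min one_pos hm
  have hε0 : ∀ N, 0 < ε N := fun N => mul_pos hε1 (by positivity)
  have hεle : ∀ N, ε N ≤ min 1 (f m) := fun N =>
    mul_le_of_le_one_right hε1.le ((div_le_one (by positivity)).2 (by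
      have : (0 : ℝ) ≤ N := N.cast_nonneg
      linarith))
  have hεlim : Tendsto ε atTop (𝓝 0) := by
    have h := (tendsto_one_div_add_atTop_nhds_zero_nat (𝕜 := ℝ)).const_mul (min 1 (f m))
    rwa [mul_zero] at h
  have hg : ∀ N x, 0 < f x + ε N := fun N x => add_pos_of_nonneg_of_pos (hnn x) (hε0 N)
  set F : ℕ → ℝ → ℝ := fun N x => |deriv (deriv f) x| ^ (p / 2) * (f x + ε N) ^ (p / 2 - q) with hF
  have hFc : ∀ N, Continuous (F N) := fun N =>
    (hc2.abs.rpow_const fun _ => Or.inr (by positivity)).mul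
      ((hc0.add continuous_const).rpow_const fun x => Or.inl (hg N x).ne')
  have hF0 : ∀ N x, 0 ≤ F N x := fun N x =>
    mul_nonneg (by positivity) (Real.rpow_nonneg (hg N x).le _)
  have hFi : ∀ N, Integrable (F N) := fun N => by
    refine (hFc N).integrable_of_hasCompactSupport (hsupp.deriv.mono fun x hx h0 => hx ?_)
    simp [hF, h0, Real.zero_rpow (by positivity : p / 2 ≠ 0)]
  have hFb : ∀ N, ∫ x in S, F N x ≤ C * (A + (l - -l)) := by
    intro N
    have hdg : deriv (fun x => f x + ε N) = deriv f := funext fun x => deriv_add_const (ε N)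
    have h1 := hmain (fun x => f x + ε N) (hf.add contDiff_const) (hg N)
      (fun x => add_le_add (hG x) ((hεle N).trans (min_le_left _ _)))
      (fun x => by rw [iteratedDeriv_succ', hdg]; exact hM x) (-l) l (by linarith)
    rw [hdg] at h1
    have h2 : Real.log 2 ≤ ∫ x in (-l)..l, |deriv f x| / (f x + ε N) := by
      have h3 := abs_log_sub_log_le_integral (hf1.add contDiff_const) (hg N) (x := m) (y := z)
        (abs_le.1 hlm) (abs_le.1 hlz)
      rw [hdg] at h3
      refine le_trans (le_trans ?_ (le_abs_self _)) h3
      rw [hz, zero_add, ← Real.log_div (hg N m).ne' (hε0 N).ne']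
      refine Real.log_le_log (by norm_num) ((le_div_iff₀ (hε0 N)).2 ?_)
      have := (hεle N).trans (min_le_right _ _)
      linarith
    have h4 := integral_regularized_weight_le hp0 hθ hf1 hnn hsupp hX (hε0 N)
      (show -l ≤ l by linarith)
    have hcq : Continuous fun x => |deriv f x| ^ p * (f x + ε N) ^ (-q) :=
      ((hf1.continuous_deriv le_rfl).abs.rpow_const fun _ => Or.inr hp0.le).mul
        ((hc0.add continuous_const).rpow_const fun x => Or.inl (hg N x).ne')
    have h5 := h1 h2
    rw [intervalIntegral.integral_add (hcq.intervalIntegrable _ _)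
      (continuous_const.intervalIntegrable _ _), intervalIntegral.integral_const, smul_eq_mul,
      mul_one] at h5
    calc ∫ x in S, F N x ≤ ∫ x, F N x :=
          setIntegral_le_integral (hFi N) (Eventually.of_forall (hF0 N))
      _ = ∫ x in Ioc (-l) l, F N x :=
          (setIntegral_eq_integral_of_forall_compl_eq_zero fun x hx => by
            simp [hF, hout x hx, Real.zero_rpow (by positivity : p / 2 ≠ 0)]).symm
      _ = ∫ x in (-l)..l, F N x := (intervalIntegral.integral_of_le (by linarith)).symm
      _ ≤ _ := h5.trans (by gcongr)
  refine integrable_of_tendsto (G := F) ?_ (fun N => (hFc N).aestronglyMeasurable) ?_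
  · filter_upwards [ae_restrict_mem hSm] with x hx
    have hx : 0 < f x := hx
    have h1 : Tendsto (fun N => f x + ε N) atTop (𝓝 (f x)) := by
      simpa using hεlim.const_add (f x)
    have h2 := (h1.rpow_const (p := p / 2 - q) (Or.inl hx.ne')).const_mul
      (|deriv (deriv f) x| ^ (p / 2))
    convert h2 using 2
    rw [Real.div_rpow (Real.sqrt_nonneg _) (by positivity), ← Real.rpow_mul hx.le, ← hq,
      Real.sqrt_eq_rpow, ← Real.rpow_mul (by positivity), Real.mul_rpow hx.le (abs_nonneg _),
      Real.rpow_sub hx, show 1 / 2 * p = p / 2 by ring]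
    ring
  · have hle : ∀ N, ∫⁻ x in S, ‖F N x‖ₑ ≤ ENNReal.ofReal (C * (A + (l - -l))) := by
      intro N
      rw [← ofReal_integral_norm_eq_lintegral_enorm (hFi N).integrableOn]
      refine ENNReal.ofReal_le_ofReal ?_
      simpa only [Real.norm_of_nonneg (hF0 N _)] using hFb N
    exact ((liminf_le_of_frequently_le' (Eventually.of_forall hle).frequently).trans_lt
      ENNReal.ofReal_lt_top).ne

theorem power_weight_inequality_large_theta
    (p θ : ℝ) (hp : 2 ≤ p) (hθ : 1 / p < θ)
    (f : ℝ → ℝ) (hf : ContDiff ℝ (⊤ : ℕ∞) f) (hnn : ∀ x, 0 ≤ f x)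
    (hsupp : HasCompactSupport (deriv f)) :
    ∫ x in {x : ℝ | 0 < f x}, (|deriv f x| / f x ^ θ) ^ p ≤
      ((p - 1) / (θ * p - 1)) ^ (p / 2) *
        ∫ x in {x : ℝ | 0 < f x},
          (Real.sqrt (f x * |deriv (deriv f) x|) / f x ^ θ) ^ p := by
  have hp0 : 0 < p := by linarith
  have hθp : 1 < θ * p := (div_lt_iff₀ hp0).1 hθ
  have hθ0 : 0 ≤ θ := (by positivity : (0 : ℝ) ≤ 1 / p).trans hθ.le
  by_cases hX : IntegrableOn (fun x => (|deriv f x| / f x ^ θ) ^ p) {x : ℝ | 0 < f x}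
  · exact power_weight_inequality_of_integrable hp hθp hf hnn hsupp hX
      (integrableOn_sqrt_mul_deriv_deriv hp hθ0 hf hnn hsupp hX)
  · rw [integral_undef hX]
    refine mul_nonneg (Real.rpow_nonneg (div_nonneg (by linarith) (by linarith)) _)
      (integral_nonneg fun x => ?_)
    exact Real.rpow_nonneg (div_nonneg (Real.sqrt_nonneg _) (Real.rpow_nonneg (hnn x) _)) _
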